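/- Fix ℓ, η ∈ ℂ with sinh(η) ≠ 0. Let M be the complex vector space with basis (m_n)_{n≥1} (m₀ := 0), and let L̃(x) be the operator on ℂ²⊗M with 2×2 block matrix [[Ã(x), B̃],[C̃, D̃(x)]], where Ã(x)m_n = sinh(x+(3/2+ℓ−n)η)·m_n, B̃ m_n = sinh(η)·e^{(n−ℓ−1/2)η}·m_{n+1}, C̃ m_n = [sinh((n−1)η)·sinh((2ℓ+2−n)η)/sinh(η)]·e^{(ℓ+3/2−n)η}·m_{n−1}, D̃(x)m_n = sinh(x+(n−ℓ−1/2)η)·m_n. Let Ř(u) be the 4×4 6-vertex matrix indexed by {1,2}² with entries Ř(u)_{(1,1),(1,1)} = Ř(u)_{(2,2),(2,2)} = sinh(u+η), Ř(u)_{(1,2),(1,2)} = Ř(u)_{(2,1),(2,1)} = sinh(u), Ř(u)_{(1,2),(2,1)} = Ř(u)_{(2,1),(1,2)} = sinh(η), other entries zero. On ℂ²⊗ℂ²⊗M let Ř₁₂(u) act by Ř(u) on the first two factors and identity on M, let L̃₁₃(u) act by L̃(u) on factors 1 and 3 (identity on factor 2), and L̃₂₃(u) by L̃(u) on factors 2 and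 3 (identity on factor 1). Then for all complex x, y, z: Ř₁₂(x−y)·L̃₁₃(x−z)·L̃₂₃(y−z) = L̃₂₃(y−z)·L̃₁₃(x−z)·Ř₁₂(x−y). -/

import Mathlib

open Complex

/-- The diagonal block `Ã(x)`: `Ã(x) m_n = sinh(x+(3/2+ℓ−n)η)·m_n`. Vectors of the
Verma-type module `M` with basis `(m_n)_{n ≥ 1}` are modelled by coordinate
functions `ℕ+ → ℂ`. -/
noncomputable def Aop (ℓ η x : ℂ) (f : ℕ+ → ℂ) : ℕ+ → ℂ :=
  fun n => sinh (x + (3 / 2 + ℓ - ((n : ℕ) : ℂ)) * η) * f n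

/-- The raising block `B̃`: `B̃ m_n = sinh(η)·e^{(n−ℓ−1/2)η}·m_{n+1}`, in coordinates. -/
noncomputable def Bop (ℓ η : ℂ) (f : ℕ+ → ℂ) : ℕ+ → ℂ :=
  fun n =>
    if 1 < (n : ℕ) then
      sinh η * Complex.exp ((((n : ℕ) : ℂ) - 1 - ℓ - 1 / 2) * η) * f (n - 1)
    else 0

/-- The lowering block `C̃`:
`C̃ m_n = [sinh((n−1)η)·sinh((2ℓ+2−n)η)/sinh(η)]·e^{(ℓ+3/2−n)η}·m_{n−1}` (`m₀ := 0`),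
in coordinates. -/
noncomputable def Cop (ℓ η : ℂ) (f : ℕ+ → ℂ) : ℕ+ → ℂ :=
  fun n =>
    sinh (((n : ℕ) : ℂ) * η) * sinh ((2 * ℓ + 1 - ((n : ℕ) : ℂ)) * η) / sinh η
      * Complex.exp ((ℓ + 1 / 2 - ((n : ℕ) : ℂ)) * η) * f (n + 1)

/-- The diagonal block `D̃(x)`: `D̃(x) m_n = sinh(x+(n−ℓ−1/2)η)·m_n`. -/
noncomputable def Dop (ℓ η x : ℂ) (f : ℕ+ → ℂ) : ℕ+ → ℂ :=
  fun n => sinh (x + (((n : ℕ) : ℂ) - ℓ - 1 / 2) * η) * f n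

/-- The unnormalized 6-vertex R-matrix `Ř(u)`, indexed by `{1,2}²` (modelled by
`Fin 2 × Fin 2`). -/
noncomputable def sixVertexR (η u : ℂ) (p q : Fin 2 × Fin 2) : ℂ :=
  if p = q then (if p.1 = p.2 then sinh (u + η) else sinh u)
  else if p.1 = q.2 ∧ p.2 = q.1 ∧ p.1 ≠ p.2 then sinh η
  else 0

/-- `Ř₁₂(u)` acting in the two auxiliary factors of `ℂ²⊗ℂ²⊗M`. -/
noncomputable def R12act (η u : ℂ) (f : Fin 2 × Fin 2 × ℕ+ → ℂ) :
    Fin 2 × Fin 2 × ℕ+ → ℂ :=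
  fun p => ∑ a : Fin 2, ∑ b : Fin 2,
    sixVertexR η u (p.1, p.2.1) (a, b) * f (a, b, p.2.2)

/-- `L̃₁₃(u)`: the L-operator acting in factors 1 and 3 of `ℂ²⊗ℂ²⊗M`. -/
noncomputable def L13act (ℓ η x : ℂ) (f : Fin 2 × Fin 2 × ℕ+ → ℂ) :
    Fin 2 × Fin 2 × ℕ+ → ℂ :=
  fun p =>
    if p.1 = 0 then
      Aop ℓ η x (fun n => f (0, p.2.1, n)) p.2.2 + Bop ℓ η (fun n => f (1, p.2.1, n)) p.2.2
    else
      Cop ℓ η (fun n => f (0, p.2.1, n)) p.2.2 + Dop ℓ η x (fun n => f (1, p.2.1, n)) p.2.2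

/-- `L̃₂₃(u)`: the L-operator acting in factors 2 and 3 of `ℂ²⊗ℂ²⊗M`. -/
noncomputable def L23act (ℓ η x : ℂ) (f : Fin 2 × Fin 2 × ℕ+ → ℂ) :
    Fin 2 × Fin 2 × ℕ+ → ℂ :=
  fun p =>
    if p.2.1 = 0 then
      Aop ℓ η x (fun n => f (p.1, 0, n)) p.2.2 + Bop ℓ η (fun n => f (p.1, 1, n)) p.2.2
    else
      Cop ℓ η (fun n => f (p.1, 0, n)) p.2.2 + Dop ℓ η x (fun n => f (p.1, 1, n)) p.2.2

theorem Bop_one' (ℓ η : ℂ) (f : ℕ+ → ℂ) : Bop ℓ η f 1 = 0 := by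
  simp [Bop]

theorem Bop_succ' (ℓ η : ℂ) (f : ℕ+ → ℂ) (n : ℕ+) :
    Bop ℓ η f (n + 1) = sinh η * Complex.exp ((((n : ℕ) : ℂ) - ℓ - 1 / 2) * η) * f n := by
  have h : n + 1 - 1 = n := by
    apply PNat.eq
    rw [PNat.sub_coe]
    simp
  have h1 : 1 < ((n + 1 : ℕ+) : ℕ) := by
    have := n.pos
    simp
  unfold Bop
  rw [if_pos h1, h]
  push_cast
  ring_nf

theorem R12_00 (η u : ℂ) (f : Fin 2 × Fin 2 × ℕ+ → ℂ) (n : ℕ+) :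
    R12act η u f (0, 0, n) = sinh (u + η) * f (0, 0, n) := by
  simp [R12act, sixVertexR]

theorem R12_11 (η u : ℂ) (f : Fin 2 × Fin 2 × ℕ+ → ℂ) (n : ℕ+) :
    R12act η u f (1, 1, n) = sinh (u + η) * f (1, 1, n) := by
  simp [R12act, sixVertexR]

theorem R12_01 (η u : ℂ) (f : Fin 2 × Fin 2 × ℕ+ → ℂ) (n : ℕ+) :
    R12act η u f (0, 1, n) = sinh u * f (0, 1, n) + sinh η * f (1, 0, n) := by
  simp [R12act, sixVertexR]

theorem R12_10 (η u : ℂ) (f : Fin 2 × Fin 2 × ℕ+ → ℂ) (n : ℕ+) :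
    R12act η u f (1, 0, n) = sinh η * f (0, 1, n) + sinh u * f (1, 0, n) := by
  simp [R12act, sixVertexR]

theorem pnat_cases' (n : ℕ+) : n = 1 ∨ ∃ m : ℕ+, n = m + 1 := by
  induction n using PNat.recOn with
  | one => left; rfl
  | succ m _ => right; exact ⟨m, rfl⟩

/-- The RLL relation (equation (RLL) with `k = ℓ = ½` and state space the Verma
module `M^ℓ`, `ℓ ∈ ℂ`) for the unnormalized spin-½ L-operator and the
unnormalized 6-vertex R-matrix:
`Ř₁₂(x−y)·L̃₁₃(x−z)·L̃₂₃(y−z) = L̃₂₃(y−z)·L̃₁₃(x−z)·Ř₁₂(x−y)`. -/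
theorem RLL_relation (ℓ η : ℂ) (hη : sinh η ≠ 0) (x y z : ℂ) :
    ∀ f : Fin 2 × Fin 2 × ℕ+ → ℂ,
      R12act η (x - y) (L13act ℓ η (x - z) (L23act ℓ η (y - z) f))
        = L23act ℓ η (y - z) (L13act ℓ η (x - z) (R12act η (x - y) f)) := by
  intro f
  obtain ⟨T, e2⟩ : ∃ T, Complex.exp (1 / 2 * η) = T := ⟨_, rfl⟩
  obtain ⟨E, eE⟩ : ∃ E, Complex.exp (ℓ * η) = E := ⟨_, rfl⟩
  obtain ⟨X, eX⟩ : ∃ X, Complex.exp x = X := ⟨_, rfl⟩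
  obtain ⟨Y, eY⟩ : ∃ Y, Complex.exp y = Y := ⟨_, rfl⟩
  obtain ⟨Z, eZ⟩ : ∃ Z, Complex.exp z = Z := ⟨_, rfl⟩
  have e1 : Complex.exp η = T ^ 2 := by
    rw [← e2, ← Complex.exp_nat_mul]; congr 1; push_cast; ring
  have e3 : Complex.exp (3 / 2 * η) = T ^ 3 := by
    rw [← e2, ← Complex.exp_nat_mul]; congr 1; push_cast; ring
  have el : Complex.exp (2 * ℓ * η) = E ^ 2 := by
    rw [← eE, ← Complex.exp_nat_mul]; congr 1; push_cast; ring
  have hT : T ≠ 0 := e2 ▸ Complex.exp_ne_zero _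
  have hL : E ≠ 0 := eE ▸ Complex.exp_ne_zero _
  have hX : X ≠ 0 := eX ▸ Complex.exp_ne_zero _
  have hY : Y ≠ 0 := eY ▸ Complex.exp_ne_zero _
  have hZ : Z ≠ 0 := eZ ▸ Complex.exp_ne_zero _
  have hsinh : sinh η = (T ^ 4 - 1) / (2 * T ^ 2) := by
    rw [Complex.sinh, Complex.exp_neg, e1]
    field_simp
  have hS : T ^ 4 - 1 ≠ 0 := by
    intro h
    apply hη
    rw [hsinh, h, zero_div]
  funext ⟨a, b, n⟩
  rcases pnat_cases' n with rfl | ⟨m, rfl⟩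
  · fin_cases a <;> fin_cases b <;>
    simp only [Fin.zero_eta, Fin.mk_one, Fin.isValue, R12_00, R12_01, R12_10, R12_11,
      L13act, L23act, Aop, Cop, Dop, Bop_one', Bop_succ', if_true, one_ne_zero, if_false,
      PNat.add_coe, PNat.one_coe, Nat.cast_add, Nat.cast_one] <;>
    (try simp only [hsinh]) <;>
    simp only [Complex.sinh, Complex.exp_neg, add_mul, sub_mul, one_mul, Complex.exp_add,
      Complex.exp_sub, e1, e2, e3, el, eE, eX, eY, eZ] <;>
    field_simp <;> ring
  · rcases pnat_cases' m with rfl | ⟨k, rfl⟩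
    · fin_cases a <;> fin_cases b <;>
      simp only [Fin.zero_eta, Fin.mk_one, Fin.isValue, R12_00, R12_01, R12_10, R12_11,
        L13act, L23act, Aop, Cop, Dop, Bop_one', Bop_succ', if_true, one_ne_zero, if_false,
        PNat.add_coe, PNat.one_coe, Nat.cast_add, Nat.cast_one] <;>
      (try simp only [hsinh]) <;>
      simp only [Complex.sinh, Complex.exp_neg, add_mul, sub_mul, one_mul, Complex.exp_add,
        Complex.exp_sub, e1, e2, e3, el, eE, eX, eY, eZ] <;>
      field_simp <;> ring
    · obtain ⟨N, eN⟩ : ∃ N, Complex.exp (((k : ℕ) : ℂ) * η) = N := ⟨_, rfl⟩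
      have hN : N ≠ 0 := eN ▸ Complex.exp_ne_zero _
      fin_cases a <;> fin_cases b <;>
      simp only [Fin.zero_eta, Fin.mk_one, Fin.isValue, R12_00, R12_01, R12_10, R12_11,
        L13act, L23act, Aop, Cop, Dop, Bop_one', Bop_succ', if_true, one_ne_zero, if_false,
        PNat.add_coe, PNat.one_coe, Nat.cast_add, Nat.cast_one] <;>
      (try simp only [hsinh]) <;>
      simp only [Complex.sinh, Complex.exp_neg, add_mul, sub_mul, one_mul, Complex.exp_add,
        Complex.exp_sub, e1, e2, e3, el, eE, eX, eY, eZ, eN] <;>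
      field_simp <;> ring
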